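/- Let x, y be integers with x + y odd and x + y ≥ 1. Then P(x + iy) = (1/(2π)) ∫_0^π e^{ixθ} (e^{iθ} + i)^{−1} ((e^{−iθ} + i)/(e^{iθ} + i))^{(x+y−1)/2} dθ. (Here (x+y−1)/2 is an integer since x+y is odd.) -/

import Mathlib

open MeasureTheory

/-- The Kasteleyn coupling function of the Burton–Pemantle measure:
`P(x+iy) = (1/4π²) ∫_{−π}^{π} ∫_{−π}^{π} e^{i(xθ−yφ)}/(2i sin θ + 2 sin φ) dθ dφ`. -/
noncomputable def Pcoup (x y : ℤ) : ℂ :=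
  1 / (4 * (Real.pi : ℂ) ^ 2) *
    ∫ θ in (-Real.pi)..Real.pi, ∫ φ in (-Real.pi)..Real.pi,
      Complex.exp (Complex.I * ((x : ℂ) * (θ : ℂ) - (y : ℂ) * (φ : ℂ))) /
        (2 * Complex.I * ((Real.sin θ : ℝ) : ℂ) + 2 * ((Real.sin φ : ℝ) : ℂ))

theorem intervalIntegrable_abs_sin_rpow (a b : ℝ) :
    IntervalIntegrable (fun t : ℝ => |Real.sin t| ^ (-(1 / 2) : ℝ)) volume a b := by
  have hper : Function.Periodic (fun t : ℝ => |Real.sin t| ^ (-(1 / 2) : ℝ)) Real.pi := fun t => by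
    simp [Real.sin_add_pi]
  refine hper.intervalIntegrable Real.pi_ne_zero (t := -(Real.pi / 2)) ?_ a b
  rw [show -(Real.pi / 2) + Real.pi = Real.pi / 2 by ring]
  have hpow : IntervalIntegrable (fun t : ℝ => |t| ^ (-(1 / 2) : ℝ)) volume
      (-(Real.pi / 2)) (Real.pi / 2) := by
    refine intervalIntegrable_of_even (fun t => by simp) (fun c hc => ?_)
    refine (intervalIntegral.intervalIntegrable_rpow' (r := -(1 / 2)) (by norm_num)).congr ?_
    intro t ht
    rw [Set.uIoc_of_le hc.le] at ht
    simp [abs_of_pos ht.1]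
  refine (hpow.const_mul ((2 / Real.pi) ^ (-(1 / 2) : ℝ))).mono_fun
    (Measurable.aestronglyMeasurable (by fun_prop)) ?_
  refine (ae_restrict_iff' measurableSet_uIoc).2 (.of_forall fun t ht => ?_)
  have hpi := Real.pi_pos
  rw [Set.uIoc_of_le (by linarith)] at ht
  have hsin := Real.mul_abs_le_abs_sin (abs_le.2 ⟨ht.1.le, ht.2⟩)
  beta_reduce
  rw [← Real.mul_rpow (by positivity) (abs_nonneg t), Real.norm_of_nonneg (by positivity),
    Real.norm_of_nonneg (by positivity)]
  rcases eq_or_ne t 0 with rfl | h0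
  · simp
  · have := abs_pos.2 h0
    exact Real.rpow_le_rpow_of_nonpos (by positivity) hsin (by norm_num)

theorem ae_sin_ne_zero : ∀ᵐ t : ℝ, Real.sin t ≠ 0 := by
  have h : {t : ℝ | Real.sin t = 0} ⊆ Set.range fun n : ℤ => (n : ℝ) * Real.pi := fun t ht => by
    simpa using Real.sin_eq_zero_iff.1 ht
  have := ((Set.countable_range _).mono h).measure_zero volume
  simpa [ae_iff] using this

theorem norm_inv_two_I_mul_add_le {a b : ℝ} (ha : a ≠ 0) (hb : b ≠ 0) :
    ‖(2 * Complex.I * (a : ℂ) + 2 * (b : ℂ))⁻¹‖ ≤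
      |a| ^ (-(1 / 2) : ℝ) * |b| ^ (-(1 / 2) : ℝ) := by
  have ha' := abs_pos.2 ha
  have hb' := abs_pos.2 hb
  rw [norm_inv, ← Real.mul_rpow ha'.le hb'.le, Real.rpow_neg (by positivity), ← Real.sqrt_eq_rpow]
  refine inv_anti₀ (by positivity) ?_
  rw [Complex.norm_def]
  refine Real.sqrt_le_sqrt ?_
  simp only [Complex.normSq_apply, Complex.add_re, Complex.add_im, Complex.mul_re, Complex.mul_im,
    Complex.re_ofNat, Complex.im_ofNat, Complex.I_re, Complex.I_im, Complex.ofReal_re,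
    Complex.ofReal_im]
  nlinarith [sq_nonneg (|a| - |b|), sq_abs a, sq_abs b]

theorem integral_exp_pow_div {a b : ℂ} (hab : ‖a‖ ≠ ‖b‖) (n : ℕ) :
    ∫ u in (0 : ℝ)..2 * Real.pi, Complex.exp (Complex.I * u) ^ (n + 1) /
        (a * Complex.exp (Complex.I * u) - b) =
      if ‖b‖ < ‖a‖ then 2 * Real.pi * ((b / a) ^ n / a) else 0 := by
  have hcirc : ∫ u in (0 : ℝ)..2 * Real.pi, Complex.exp (Complex.I * u) ^ (n + 1) /
        (a * Complex.exp (Complex.I * u) - b) =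
      Complex.I⁻¹ * ∮ z in C(0, 1), z ^ n / (a * z - b) := by
    rw [circleIntegral, ← intervalIntegral.integral_const_mul]
    refine intervalIntegral.integral_congr fun u _ => ?_
    simp only [deriv_circleMap, circleMap, smul_eq_mul, Complex.ofReal_one, one_mul, zero_add,
      mul_comm (u : ℂ)]
    field_simp
    ring
  rw [hcirc]
  split_ifs with h
  · have ha : a ≠ 0 := norm_pos_iff.1 ((norm_nonneg b).trans_lt h)
    have hw : b / a ∈ Metric.ball (0 : ℂ) 1 := by
      simpa using (div_lt_one ((norm_nonneg b).trans_lt h)).2 h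
    have key := DifferentiableOn.circleIntegral_sub_inv_smul (f := fun z : ℂ => z ^ n / a)
      (c := 0) (R := 1) (by fun_prop) hw
    have : (fun z : ℂ => z ^ n / (a * z - b)) = fun z => (z - b / a)⁻¹ • (z ^ n / a) := by
      funext z
      rw [show a * z - b = a * (z - b / a) by field_simp, smul_eq_mul, div_eq_mul_inv, mul_inv]
      ring
    rw [this, key, smul_eq_mul]
    field_simp [Complex.I_ne_zero]
  · have hlt : ‖a‖ < ‖b‖ := lt_of_le_of_ne (not_lt.1 h) hab
    have hd : DifferentiableOn ℂ (fun z : ℂ => z ^ n / (a * z - b)) (Metric.closedBall 0 1) := by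
      refine DifferentiableOn.div (by fun_prop) (by fun_prop) fun z hz h0 => ?_
      have hz' : ‖z‖ ≤ 1 := by simpa using hz
      have : ‖b‖ ≤ ‖a‖ := by
        rw [← sub_eq_zero.1 h0, norm_mul]
        exact mul_le_of_le_one_right (norm_nonneg a) hz'
      linarith
    rw [(hd.mono Metric.closure_ball_subset_closedBall).diffContOnCl.circleIntegral_eq_zero zero_le_one,
      mul_zero]

theorem integral_exp_two_mul_pow_div {a b : ℂ} (hab : ‖a‖ ≠ ‖b‖) (n : ℕ) :
    ∫ u in (-Real.pi)..Real.pi, Complex.exp (Complex.I * (2 * u : ℝ)) ^ (n + 1) /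
        (a * Complex.exp (Complex.I * (2 * u : ℝ)) - b) =
      if ‖b‖ < ‖a‖ then 2 * Real.pi * ((b / a) ^ n / a) else 0 := by
  set F : ℝ → ℂ := fun u => Complex.exp (Complex.I * u) ^ (n + 1) /
        (a * Complex.exp (Complex.I * u) - b) with hF
  have hper : Function.Periodic F (2 * Real.pi) := fun u => by
    have : Complex.exp (Complex.I * ((u + 2 * Real.pi : ℝ) : ℂ)) = Complex.exp (Complex.I * u) := by
      rw [← Complex.exp_periodic (Complex.I * u)]
      push_cast; ring_nf
    simp only [hF, this]
  have hcont : Continuous F := by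
    refine Continuous.div (by fun_prop) (by fun_prop) fun u h0 => hab ?_
    rw [← sub_eq_zero.1 h0, norm_mul, Complex.norm_exp_I_mul_ofReal, mul_one]
  have h1 := intervalIntegral.integral_comp_mul_left (a := -Real.pi) (b := Real.pi) F
    (two_ne_zero (α := ℝ))
  have h2 := hper.intervalIntegral_add_zsmul_eq 2 (2 * -Real.pi) fun _ _ =>
    hcont.intervalIntegrable _ _
  have h3 := hper.intervalIntegral_add_eq (2 * -Real.pi) 0
  rw [show 2 * -Real.pi + (2 : ℤ) • (2 * Real.pi) = 2 * Real.pi by simp; ring, h3, zero_add] at h2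
  rw [h1, h2, integral_exp_pow_div hab]
  simp

theorem integrableOn_pcoup_integrand_shear (x y : ℤ) :
    IntegrableOn (Function.uncurry fun α β : ℝ =>
      Complex.exp (Complex.I * ((x : ℂ) * (α : ℂ) - (y : ℂ) * ((β - α : ℝ) : ℂ))) /
        (2 * Complex.I * ((Real.sin α : ℝ) : ℂ) + 2 * ((Real.sin (β - α) : ℝ) : ℂ)))
      (Set.uIoc (-Real.pi) Real.pi ×ˢ Set.uIoc (-Real.pi) Real.pi) := by
  have hpi := Real.pi_pos
  set f : ℝ × ℝ → ℂ := fun p =>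
    Complex.exp (Complex.I * ((x : ℂ) * (p.1 : ℂ) - (y : ℂ) * (p.2 : ℂ))) /
      (2 * Complex.I * ((Real.sin p.1 : ℝ) : ℂ) + 2 * ((Real.sin p.2 : ℝ) : ℂ)) with hf
  set R : Set (ℝ × ℝ) := Set.Ioc (-Real.pi) Real.pi ×ˢ Set.Ioc (-(2 * Real.pi)) (2 * Real.pi)
  have hprod : IntegrableOn (fun p : ℝ × ℝ =>
      |Real.sin p.1| ^ (-(1 / 2) : ℝ) * |Real.sin p.2| ^ (-(1 / 2) : ℝ)) R := by
    rw [IntegrableOn, Measure.volume_eq_prod, ← Measure.prod_restrict]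
    refine Integrable.mul_prod (f := fun t : ℝ => |Real.sin t| ^ (-(1 / 2) : ℝ))
      (g := fun t : ℝ => |Real.sin t| ^ (-(1 / 2) : ℝ)) ?_ ?_
    · exact (intervalIntegrable_iff_integrableOn_Ioc_of_le (by linarith)).1
        (intervalIntegrable_abs_sin_rpow _ _)
    · exact (intervalIntegrable_iff_integrableOn_Ioc_of_le (by linarith)).1
        (intervalIntegrable_abs_sin_rpow _ _)
  have hfR : IntegrableOn f R := by
    refine Integrable.mono' hprod (Measurable.aestronglyMeasurable (by fun_prop)) ?_
    have h1 : ∀ᵐ p : ℝ × ℝ, Real.sin p.1 ≠ 0 :=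
      Measure.quasiMeasurePreserving_fst.ae ae_sin_ne_zero
    have h2 : ∀ᵐ p : ℝ × ℝ, Real.sin p.2 ≠ 0 :=
      Measure.quasiMeasurePreserving_snd.ae ae_sin_ne_zero
    filter_upwards [ae_restrict_of_ae h1, ae_restrict_of_ae h2] with p hp1 hp2
    have hexp : Complex.I * ((x : ℂ) * (p.1 : ℂ) - (y : ℂ) * (p.2 : ℂ)) =
        Complex.I * ((x * p.1 - y * p.2 : ℝ) : ℂ) := by push_cast; ring
    rw [hf]
    simp only
    rw [div_eq_mul_inv, norm_mul, hexp, Complex.norm_exp_I_mul_ofReal, one_mul]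
    exact norm_inv_two_I_mul_add_le hp1 hp2
  have hshear : MeasurePreserving (fun z : ℝ × ℝ => (z.1, -z.1 + z.2)) volume volume :=
    measurePreserving_prod_neg_add volume volume
  have hR : MeasurableSet R := measurableSet_Ioc.prod measurableSet_Ioc
  have hcomp := (hshear.restrict_preimage hR).integrable_comp_of_integrable hfR
  have hsub : Set.uIoc (-Real.pi) Real.pi ×ˢ Set.uIoc (-Real.pi) Real.pi ⊆
      (fun z : ℝ × ℝ => (z.1, -z.1 + z.2)) ⁻¹' R := by
    rw [Set.uIoc_of_le (by linarith)]
    rintro ⟨α, β⟩ ⟨⟨h1, h2⟩, h3, h4⟩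
    simp only at h1 h2 h3 h4
    exact ⟨⟨h1, h2⟩, by simp only; linarith, by simp only; linarith⟩
  refine (IntegrableOn.mono_set hcomp hsub).congr_fun (fun p _ => ?_)
    (measurableSet_uIoc.prod measurableSet_uIoc)
  simp only [hf, Function.comp, Function.uncurry, neg_add_eq_sub]

theorem two_I_mul_sin_add_two_mul_sin_sub (α β : ℝ) :
    2 * Complex.I * ((Real.sin α : ℝ) : ℂ) + 2 * ((Real.sin (β - α) : ℝ) : ℂ) =
      Complex.exp (-(Complex.I * α)) *
        ((1 + Complex.I * Complex.exp (-(Complex.I * β))) * Complex.exp (Complex.I * (2 * α : ℝ)) -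
          (1 + Complex.I * Complex.exp (Complex.I * β))) := by
  have hs := Complex.exp_ne_zero (Complex.I * α)
  have hp := Complex.exp_ne_zero (Complex.I * β)
  have hdouble : Complex.exp (Complex.I * (2 * α : ℝ)) = Complex.exp (Complex.I * α) ^ 2 := by
    rw [← Complex.exp_nat_mul]
    push_cast
    ring_nf
  have hα : -(α : ℂ) * Complex.I = -(Complex.I * α) := by ring
  have hβα : ((β : ℂ) - α) * Complex.I = Complex.I * β - Complex.I * α := by ring
  have hαβ : -((β : ℂ) - α) * Complex.I = Complex.I * α - Complex.I * β := by ring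
  rw [hdouble, Complex.ofReal_sin, Complex.ofReal_sin, Complex.ofReal_sub]
  simp only [Complex.sin, hα, hβα, hαβ, mul_comm (α : ℂ) Complex.I, Complex.exp_sub,
    Complex.exp_neg]
  field_simp
  linear_combination (Complex.exp (Complex.I * β) -
    Complex.exp (Complex.I * α) ^ 2 * Complex.exp (Complex.I * β)) * Complex.I_sq

theorem sq_norm_one_add_I_mul_exp (β : ℝ) :
    ‖1 + Complex.I * Complex.exp (Complex.I * β)‖ ^ 2 = 2 - 2 * Real.sin β := by
  rw [Complex.sq_norm, mul_comm Complex.I (β : ℂ), Complex.exp_mul_I, ← Complex.ofReal_cos,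
    ← Complex.ofReal_sin]
  simp only [Complex.normSq_apply, Complex.add_re, Complex.add_im, Complex.mul_re, Complex.mul_im,
    Complex.one_re, Complex.one_im, Complex.I_re, Complex.I_im, Complex.ofReal_re,
    Complex.ofReal_im]
  linear_combination Real.sin_sq_add_cos_sq β

theorem sq_norm_one_add_I_mul_exp_neg (β : ℝ) :
    ‖1 + Complex.I * Complex.exp (-(Complex.I * β))‖ ^ 2 = 2 + 2 * Real.sin β := by
  have := sq_norm_one_add_I_mul_exp (-β)
  rw [Complex.ofReal_neg, mul_neg, Real.sin_neg] at this
  rw [this]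
  ring

theorem integral_pcoup_integrand_shear {x y : ℤ} {m : ℕ} (hm : x + y = 2 * m + 1) {β : ℝ}
    (hβ : Real.sin β ≠ 0) :
    ∫ α in (-Real.pi)..Real.pi,
      Complex.exp (Complex.I * ((x : ℂ) * (α : ℂ) - (y : ℂ) * ((β - α : ℝ) : ℂ))) /
        (2 * Complex.I * ((Real.sin α : ℝ) : ℂ) + 2 * ((Real.sin (β - α) : ℝ) : ℂ)) =
      if 0 < Real.sin β then
        2 * Real.pi * (Complex.exp (Complex.I * (x : ℂ) * (β : ℂ)) *
          (Complex.exp (Complex.I * (β : ℂ)) + Complex.I)⁻¹ *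
          ((Complex.exp (-(Complex.I * (β : ℂ))) + Complex.I) /
            (Complex.exp (Complex.I * (β : ℂ)) + Complex.I)) ^ m)
      else 0 := by
  set a := 1 + Complex.I * Complex.exp (-(Complex.I * β)) with ha
  set b := 1 + Complex.I * Complex.exp (Complex.I * β) with hb
  have hsa : ‖a‖ ^ 2 = 2 + 2 * Real.sin β := sq_norm_one_add_I_mul_exp_neg β
  have hsb : ‖b‖ ^ 2 = 2 - 2 * Real.sin β := sq_norm_one_add_I_mul_exp β
  have hab : ‖a‖ ≠ ‖b‖ := fun h => hβ (by rw [h, hsb] at hsa; linarith)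
  have hlt : ‖b‖ < ‖a‖ ↔ 0 < Real.sin β := by
    rw [← sq_lt_sq₀ (norm_nonneg b) (norm_nonneg a), hsa, hsb]
    constructor <;> intro h <;> linarith
  have hxy : (x : ℂ) + y = 2 * m + 1 := by exact_mod_cast hm
  have hint : ∀ α : ℝ,
      Complex.exp (Complex.I * ((x : ℂ) * (α : ℂ) - (y : ℂ) * ((β - α : ℝ) : ℂ))) /
        (2 * Complex.I * ((Real.sin α : ℝ) : ℂ) + 2 * ((Real.sin (β - α) : ℝ) : ℂ)) =
      Complex.exp (-(Complex.I * y * β)) *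
        (Complex.exp (Complex.I * (2 * α : ℝ)) ^ (m + 1) /
          (a * Complex.exp (Complex.I * (2 * α : ℝ)) - b)) := fun α => by
    rw [two_I_mul_sin_add_two_mul_sin_sub, ← ha, ← hb, div_mul_eq_div_div, ← mul_div_assoc,
      ← Complex.exp_nat_mul, ← Complex.exp_sub, ← Complex.exp_add]
    congr 2
    push_cast
    linear_combination (Complex.I * α) * hxy
  simp_rw [hint]
  rw [intervalIntegral.integral_const_mul, integral_exp_two_mul_pow_div hab]
  simp only [hlt]
  split_ifs with h
  · set p := Complex.exp (Complex.I * β) with hp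
    have hp0 : p ≠ 0 := Complex.exp_ne_zero _
    have hpneg : Complex.exp (-(Complex.I * β)) = p⁻¹ := Complex.exp_neg _
    have ha' : a = (p + Complex.I) / p := by rw [ha, hpneg]; field_simp
    have hb' : b = p * (p⁻¹ + Complex.I) := by rw [hb]; field_simp
    have hx : Complex.exp (Complex.I * x * β) =
        Complex.exp (-(Complex.I * y * β)) * p ^ (2 * m + 1) := by
      rw [hp, ← Complex.exp_nat_mul, ← Complex.exp_add]
      congr 1
      push_cast
      linear_combination (Complex.I * β) * hxy
    have hba : b / a = p ^ 2 * ((p⁻¹ + Complex.I) / (p + Complex.I)) := by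
      rw [ha', hb', div_div_eq_mul_div]; ring
    rw [hba, hpneg, hx, ha', mul_pow, div_div_eq_mul_div]
    ring
  · simp

theorem pcoup_eq_integral_shear (x y : ℤ) :
    Pcoup x y = 1 / (4 * (Real.pi : ℂ) ^ 2) *
      ∫ β in (-Real.pi)..Real.pi, ∫ α in (-Real.pi)..Real.pi,
        Complex.exp (Complex.I * ((x : ℂ) * (α : ℂ) - (y : ℂ) * ((β - α : ℝ) : ℂ))) /
          (2 * Complex.I * ((Real.sin α : ℝ) : ℂ) + 2 * ((Real.sin (β - α) : ℝ) : ℂ)) := by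
  rw [Pcoup, ← intervalIntegral_intervalIntegral_swap (integrableOn_pcoup_integrand_shear x y)]
  congr 1
  refine intervalIntegral.integral_congr fun α _ => ?_
  set g : ℝ → ℂ := fun φ =>
    Complex.exp (Complex.I * ((x : ℂ) * (α : ℂ) - (y : ℂ) * (φ : ℂ))) /
      (2 * Complex.I * ((Real.sin α : ℝ) : ℂ) + 2 * ((Real.sin φ : ℝ) : ℂ)) with hg
  have hper : Function.Periodic g (2 * Real.pi) := fun φ => by
    simp only [hg, Real.sin_add_two_pi]
    congr 1
    rw [← Complex.exp_periodic.int_mul (-y) (Complex.I * (x * α - y * φ))]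
    congr 1
    push_cast
    ring
  have h1 := hper.intervalIntegral_add_eq (-Real.pi) (-Real.pi - α)
  rw [show -Real.pi + 2 * Real.pi = Real.pi by ring,
    show -Real.pi - α + 2 * Real.pi = Real.pi - α by ring] at h1
  rw [h1, ← intervalIntegral.integral_comp_sub_right]

/-- The single-integral representation of `P` from Section 4: for integers `x, y` with
`x + y` odd and `x + y ≥ 1`,
`P(x+iy) = (1/2π) ∫_0^π e^{ixθ} (e^{iθ}+i)^{−1} ((e^{−iθ}+i)/(e^{iθ}+i))^{(x+y−1)/2} dθ`. -/
theorem stmt_16 (x y : ℤ) (hodd : Odd (x + y)) (hge : 1 ≤ x + y) :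
    Pcoup x y =
      1 / (2 * (Real.pi : ℂ)) *
        ∫ θ in (0 : ℝ)..Real.pi,
          Complex.exp (Complex.I * (x : ℂ) * (θ : ℂ)) *
            (Complex.exp (Complex.I * (θ : ℂ)) + Complex.I)⁻¹ *
            ((Complex.exp (-(Complex.I * (θ : ℂ))) + Complex.I) /
                (Complex.exp (Complex.I * (θ : ℂ)) + Complex.I)) ^ ((x + y - 1) / 2) := by
  have hpi := Real.pi_pos
  obtain ⟨k, hk⟩ := hodd
  lift k to ℕ using by omega with m
  have hpow : (x + y - 1) / 2 = (m : ℤ) := by omega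
  rw [pcoup_eq_integral_shear, hpow, intervalIntegral.integral_of_le (by linarith),
    setIntegral_eq_of_subset_of_ae_sdiff_eq_zero (s := Set.Ioc 0 Real.pi)
      measurableSet_Ioc.nullMeasurableSet (Set.Ioc_subset_Ioc_left (by linarith)),
    setIntegral_congr_ae (g := fun β : ℝ => 2 * Real.pi *
        (Complex.exp (Complex.I * (x : ℂ) * (β : ℂ)) *
          (Complex.exp (Complex.I * (β : ℂ)) + Complex.I)⁻¹ *
          ((Complex.exp (-(Complex.I * (β : ℂ))) + Complex.I) /
            (Complex.exp (Complex.I * (β : ℂ)) + Complex.I)) ^ m)) measurableSet_Ioc,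
    integral_const_mul, ← intervalIntegral.integral_of_le hpi.le]
  · simp only [zpow_natCast]
    have : (Real.pi : ℂ) ≠ 0 := by exact_mod_cast hpi.ne'
    field_simp
    norm_num
  · filter_upwards [ae_sin_ne_zero] with β hβ hmem
    have hsin : 0 < Real.sin β :=
      lt_of_le_of_ne (Real.sin_nonneg_of_nonneg_of_le_pi hmem.1.le hmem.2) hβ.symm
    rw [integral_pcoup_integrand_shear hk hβ, if_pos hsin]
  · filter_upwards [ae_sin_ne_zero] with β hβ hmem
    have hβ0 : β ≤ 0 := by
      by_contra! h
      exact hmem.2 ⟨h, hmem.1.2⟩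
    have hsin : ¬ 0 < Real.sin β :=
      not_lt.2 (Real.sin_nonpos_of_nonpos_of_neg_pi_le hβ0 hmem.1.1.le)
    rw [integral_pcoup_integrand_shear hk hβ, if_neg hsin]
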